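/- arXiv:2303.09716 — 4 statements merged into one kernel-verified Lean document; each statement's English description precedes it below -/
import Mathlib

section
/- Let H ≥ 1 be an integer, V ∈ ℝ^S, and let (μ,ν) be an H-step lookahead policy for V. Then ‖T_{μ,ν}(T^{H−1}V) − T^{H−1}V‖_∞ ≤ (α^H + α^{H−1})·‖V − J*‖_∞. -/
open Finset Filter Topology Matrix

noncomputable section

/-- The probability simplex over a finite subset `D` of actions: nonnegative
weights summing to one over `D` and vanishing outside `D`. -/
def simplex {A : Type*} [Fintype A] (D : Finset A) : Set (A → ℝ) :=
  {p | (∀ a, 0 ≤ p a) ∧ (∑ a ∈ D, p a = 1) ∧ ∀ a ∉ D, p a = 0}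

/-- A finite two-player zero-sum discounted Markov game. `S` is the state space,
`A` the maximizer's global action type, `B` the minimizer's global action type. -/
structure MarkovGame (S A B : Type*) [Fintype S] [Fintype A] [Fintype B] where
  U : S → Finset A
  W : S → Finset B
  U_nonempty : ∀ s, (U s).Nonempty
  W_nonempty : ∀ s, (W s).Nonempty
  P : S → A → B → S → ℝ
  P_nonneg : ∀ s u v s', 0 ≤ P s u v s'
  P_sum : ∀ s, ∀ u ∈ U s, ∀ v ∈ W s, ∑ s', P s u v s' = 1
  g : S → A → B → ℝ
  g_nonneg : ∀ s u v, 0 ≤ g s u v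
  g_le_one : ∀ s u v, g s u v ≤ 1
  α : ℝ
  α_pos : 0 < α
  α_lt_one : α < 1

namespace MarkovGame

variable {S A B : Type*} [Fintype S] [Fintype A] [Fintype B]

/-- The state-action value matrix `A_{V,s}(u,v) = g(s,u,v) + α Σ_{s'} P(s'|s,u,v) V(s')`. -/
def Aval (G : MarkovGame S A B) (V : S → ℝ) (s : S) (u : A) (v : B) : ℝ :=
  G.g s u v + G.α * ∑ s', G.P s u v s' * V s'

/-- A policy pair assigns to each state probability vectors over the available actions. -/
def IsPolicy (G : MarkovGame S A B) (μ : S → A → ℝ) (ν : S → B → ℝ) : Prop :=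
  ∀ s, μ s ∈ simplex (G.U s) ∧ ν s ∈ simplex (G.W s)

/-- The Bellman operator of a policy pair: `(T_{μ,ν}V)(s) = μ(s)ᵀ A_{V,s} ν(s)`. -/
def Tpol (G : MarkovGame S A B) (μ : S → A → ℝ) (ν : S → B → ℝ) (V : S → ℝ) : S → ℝ :=
  fun s => ∑ u ∈ G.U s, ∑ v ∈ G.W s, μ s u * ν s v * G.Aval V s u v

/-- The Bellman optimality operator:
`(TV)(s) = max_{p ∈ Δ(U(s))} min_{q ∈ Δ(V(s))} pᵀ A_{V,s} q`. -/
def T (G : MarkovGame S A B) (V : S → ℝ) : S → ℝ :=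
  fun s => sSup {x | ∃ p ∈ simplex (G.U s),
    x = sInf {y | ∃ q ∈ simplex (G.W s),
      y = ∑ u ∈ G.U s, ∑ v ∈ G.W s, p u * q v * G.Aval V s u v}}

/-- The transition matrix `P_{μ,ν}` of a policy pair. -/
def Ppol (G : MarkovGame S A B) (μ : S → A → ℝ) (ν : S → B → ℝ) : Matrix S S ℝ :=
  Matrix.of fun s s' => ∑ u ∈ G.U s, ∑ v ∈ G.W s, μ s u * ν s v * G.P s u v s'

/-- The expected one-step reward `g_{μ,ν}` of a policy pair. -/
def gpol (G : MarkovGame S A B) (μ : S → A → ℝ) (ν : S → B → ℝ) : S → ℝ :=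
  fun s => ∑ u ∈ G.U s, ∑ v ∈ G.W s, μ s u * ν s v * G.g s u v

/-- `(μ,ν)` is an `H`-step lookahead policy for `V` if it is a policy pair and
`T_{μ,ν}(T^{H-1}V) = T^H V`. -/
def IsLookahead (G : MarkovGame S A B) (H : ℕ) (μ : S → A → ℝ) (ν : S → B → ℝ)
    (V : S → ℝ) : Prop :=
  G.IsPolicy μ ν ∧ G.Tpol μ ν (G.T^[H - 1] V) = G.T^[H] V

end MarkovGame

theorem simplex_nonempty {A : Type*} [Fintype A] {D : Finset A} (hD : D.Nonempty) :
    (simplex D).Nonempty := by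
  classical
  obtain ⟨a, ha⟩ := hD
  refine ⟨Pi.single a 1, fun b => ?_, ?_, fun b hb => ?_⟩
  · by_cases h : b = a
    · subst h; simp
    · simp [h]
  · simp [Pi.single_apply, ha]
  · have h : b ≠ a := fun h => hb (h ▸ ha)
    simp [h]

section MatrixGame

variable {A B : Type*} [Fintype A] [Fintype B] {D : Finset A} {E : Finset B}

theorem payoff_le_payoff_add {M N : A → B → ℝ} {d : ℝ}
    (h : ∀ u ∈ D, ∀ v ∈ E, M u v ≤ N u v + d) {p : A → ℝ} (hp : p ∈ simplex D)
    {q : B → ℝ} (hq : q ∈ simplex E) :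
    ∑ u ∈ D, ∑ v ∈ E, p u * q v * M u v ≤ (∑ u ∈ D, ∑ v ∈ E, p u * q v * N u v) + d := by
  have hd : ∑ u ∈ D, ∑ v ∈ E, p u * q v * d = d := by
    simp_rw [← Finset.sum_mul, ← Finset.mul_sum]
    rw [hq.2.1, ← Finset.sum_mul, hp.2.1]
    ring
  calc ∑ u ∈ D, ∑ v ∈ E, p u * q v * M u v
      ≤ ∑ u ∈ D, ∑ v ∈ E, (p u * q v * N u v + p u * q v * d) := by
        refine Finset.sum_le_sum fun u hu => Finset.sum_le_sum fun v hv => ?_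
        rw [← mul_add]
        exact mul_le_mul_of_nonneg_left (h u hu v hv) (mul_nonneg (hp.1 u) (hq.1 v))
    _ = _ := by simp_rw [Finset.sum_add_distrib]; rw [hd]

theorem exists_abs_payoff_le (D : Finset A) (E : Finset B) (M : A → B → ℝ) :
    ∃ C : ℝ, ∀ p ∈ simplex D, ∀ q ∈ simplex E,
      |∑ u ∈ D, ∑ v ∈ E, p u * q v * M u v| ≤ C := by
  have hM : ∀ u ∈ D, ∀ v ∈ E, |M u v| ≤ ∑ u ∈ D, ∑ v ∈ E, |M u v| := fun u hu v hv =>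
    (Finset.single_le_sum (f := fun v => |M u v|) (fun _ _ => abs_nonneg _) hv).trans
      (Finset.single_le_sum (f := fun u => ∑ v ∈ E, |M u v|)
        (fun _ _ => Finset.sum_nonneg fun _ _ => abs_nonneg _) hu)
  refine ⟨∑ u ∈ D, ∑ v ∈ E, |M u v|, fun p hp q hq => abs_le.2 ⟨?_, ?_⟩⟩
  · have := payoff_le_payoff_add (M := fun _ _ => 0) (N := M)
      (fun u hu v hv => by linarith [neg_abs_le (M u v), hM u hu v hv]) hp hq
    simp only [mul_zero, Finset.sum_const_zero] at this
    linarith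
  · have := payoff_le_payoff_add (M := M) (N := fun _ _ => 0)
      (fun u hu v hv => by linarith [le_abs_self (M u v), hM u hu v hv]) hp hq
    simpa only [mul_zero, Finset.sum_const_zero, zero_add] using this

theorem maxmin_le_maxmin_add (hD : D.Nonempty) (hE : E.Nonempty) {M N : A → B → ℝ} {d : ℝ}
    (h : ∀ u ∈ D, ∀ v ∈ E, M u v ≤ N u v + d) :
    sSup {x | ∃ p ∈ simplex D, x = sInf {y | ∃ q ∈ simplex E,
      y = ∑ u ∈ D, ∑ v ∈ E, p u * q v * M u v}} ≤
    sSup {x | ∃ p ∈ simplex D, x = sInf {y | ∃ q ∈ simplex E,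
      y = ∑ u ∈ D, ∑ v ∈ E, p u * q v * N u v}} + d := by
  obtain ⟨p₀, hp₀⟩ := simplex_nonempty hD
  obtain ⟨q₀, hq₀⟩ := simplex_nonempty hE
  have bdd : ∀ (K : A → B → ℝ), ∀ p ∈ simplex D, BddBelow {y | ∃ q ∈ simplex E,
      y = ∑ u ∈ D, ∑ v ∈ E, p u * q v * K u v} := by
    intro K p hp
    obtain ⟨C, hC⟩ := exists_abs_payoff_le D E K
    refine ⟨-C, ?_⟩
    rintro _ ⟨q, hq, rfl⟩
    exact (abs_le.1 (hC p hp q hq)).1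
  refine csSup_le ⟨_, p₀, hp₀, rfl⟩ ?_
  rintro _ ⟨p, hp, rfl⟩
  rw [← sub_le_iff_le_add]
  refine le_csSup_of_le ?_ ⟨p, hp, rfl⟩ (le_csInf ⟨_, q₀, hq₀, rfl⟩ ?_)
  · obtain ⟨C, hC⟩ := exists_abs_payoff_le D E N
    refine ⟨C, ?_⟩
    rintro _ ⟨p, hp, rfl⟩
    exact (csInf_le (bdd N p hp) ⟨q₀, hq₀, rfl⟩).trans (abs_le.1 (hC p hp q₀ hq₀)).2
  · rintro _ ⟨q, hq, rfl⟩
    rw [sub_le_iff_le_add]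
    exact (csInf_le (bdd M p hp) ⟨q, hq, rfl⟩).trans (payoff_le_payoff_add h hp hq)

end MatrixGame

namespace MarkovGame

variable {S A B : Type*} [Fintype S] [Fintype A] [Fintype B]

theorem Aval_le_Aval_add (G : MarkovGame S A B) (V W : S → ℝ) (s : S) {u : A} (hu : u ∈ G.U s)
    {v : B} (hv : v ∈ G.W s) :
    G.Aval V s u v ≤ G.Aval W s u v + G.α * ‖V - W‖ := by
  have key : ∑ s', G.P s u v s' * V s' ≤ ∑ s', G.P s u v s' * W s' + ‖V - W‖ :=
    calc ∑ s', G.P s u v s' * V s'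
        ≤ ∑ s', (G.P s u v s' * W s' + G.P s u v s' * ‖V - W‖) := by
          refine Finset.sum_le_sum fun s' _ => ?_
          rw [← mul_add]
          refine mul_le_mul_of_nonneg_left ?_ (G.P_nonneg s u v s')
          have := (le_abs_self _).trans (norm_le_pi_norm (V - W) s')
          rw [Pi.sub_apply] at this
          linarith
      _ = _ := by rw [Finset.sum_add_distrib, ← Finset.sum_mul, G.P_sum s u hu v hv, one_mul]
  have := mul_le_mul_of_nonneg_left key G.α_pos.le
  unfold Aval
  linarith

theorem T_apply_le (G : MarkovGame S A B) (V W : S → ℝ) (s : S) :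
    G.T V s ≤ G.T W s + G.α * ‖V - W‖ :=
  maxmin_le_maxmin_add (G.U_nonempty s) (G.W_nonempty s)
    fun _ hu _ hv => G.Aval_le_Aval_add V W s hu hv

theorem norm_T_sub_T_le (G : MarkovGame S A B) (V W : S → ℝ) :
    ‖G.T V - G.T W‖ ≤ G.α * ‖V - W‖ := by
  refine (pi_norm_le_iff_of_nonneg (mul_nonneg G.α_pos.le (norm_nonneg _))).2 fun s => ?_
  have h₁ := G.T_apply_le V W s
  have h₂ := G.T_apply_le W V s
  rw [norm_sub_rev] at h₂
  rw [Pi.sub_apply, Real.norm_eq_abs, abs_le]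
  constructor <;> linarith

theorem norm_iterate_T_sub_le (G : MarkovGame S A B) {J : S → ℝ} (hJ : G.T J = J) (V : S → ℝ)
    (n : ℕ) : ‖G.T^[n] V - J‖ ≤ G.α ^ n * ‖V - J‖ := by
  induction n with
  | zero => simp
  | succ n ih =>
    rw [Function.iterate_succ_apply']
    calc ‖G.T (G.T^[n] V) - J‖ = ‖G.T (G.T^[n] V) - G.T J‖ := by rw [hJ]
      _ ≤ G.α * ‖G.T^[n] V - J‖ := G.norm_T_sub_T_le _ _
      _ ≤ G.α * (G.α ^ n * ‖V - J‖) := mul_le_mul_of_nonneg_left ih G.α_pos.le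
      _ = G.α ^ (n + 1) * ‖V - J‖ := by ring

end MarkovGame

/-- If `(μ,ν)` is an `H`-step lookahead policy for `V`, then
`‖T_{μ,ν}(T^{H−1}V) − T^{H−1}V‖_∞ ≤ (α^H + α^{H−1})‖V − J*‖_∞`. -/
theorem stmt_6 {S A B : Type*} [Fintype S] [Fintype A] [Fintype B]
    (G : MarkovGame S A B) (H : ℕ) (hH : 1 ≤ H) (V : S → ℝ)
    (μ : S → A → ℝ) (ν : S → B → ℝ) (hLA : G.IsLookahead H μ ν V)
    (Jstar : S → ℝ) (hJ : G.T Jstar = Jstar) :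
    ‖G.Tpol μ ν (G.T^[H - 1] V) - G.T^[H - 1] V‖ ≤
      (G.α ^ H + G.α ^ (H - 1)) * ‖V - Jstar‖ := by
  rw [hLA.2, add_mul]
  calc ‖G.T^[H] V - G.T^[H - 1] V‖
      ≤ ‖G.T^[H] V - Jstar‖ + ‖Jstar - G.T^[H - 1] V‖ := norm_sub_le_norm_sub_add_norm_sub _ _ _
    _ ≤ _ := by
      rw [norm_sub_rev Jstar]
      exact add_le_add (G.norm_iterate_T_sub_le hJ V H) (G.norm_iterate_T_sub_le hJ V (H - 1))
end
end

section
/- (Lemma 1) Let H ≥ 1 be an integer, V ∈ ℝ^S, and let (μ,ν) be an H-step lookahead policy for V. Then ‖J^{μ,ν} − T^{H−1}V‖_∞ ≤ (α^{H−1}/(1−α))·‖TV − V‖_∞. -/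
open Finset Filter Topology Matrix

noncomputable section

/-- Averaging against a product of two probability vectors preserves a pointwise bound up to an
additive constant. -/
theorem sum_simplex_le_add {A B : Type*} [Fintype A] [Fintype B] {D : Finset A} {E : Finset B}
    {p : A → ℝ} {q : B → ℝ} (hp : p ∈ simplex D) (hq : q ∈ simplex E) {f f' : A → B → ℝ} {c : ℝ}
    (h : ∀ u ∈ D, ∀ v ∈ E, f u v ≤ f' u v + c) :
    ∑ u ∈ D, ∑ v ∈ E, p u * q v * f u v ≤ (∑ u ∈ D, ∑ v ∈ E, p u * q v * f' u v) + c := by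
  have hc : ∑ u ∈ D, ∑ v ∈ E, p u * q v * c = c := by
    simp_rw [← Finset.sum_mul, ← Finset.mul_sum, hq.2.1, mul_one, hp.2.1, one_mul]
  calc ∑ u ∈ D, ∑ v ∈ E, p u * q v * f u v
      ≤ ∑ u ∈ D, ∑ v ∈ E, (p u * q v * f' u v + p u * q v * c) := by
        refine Finset.sum_le_sum fun u hu => Finset.sum_le_sum fun v hv => ?_
        rw [← mul_add]
        exact mul_le_mul_of_nonneg_left (h u hu v hv) (mul_nonneg (hp.1 u) (hq.1 v))
    _ = _ := by simp_rw [Finset.sum_add_distrib, hc]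

theorem exists_abs_sum_simplex_le {A B : Type*} [Fintype A] [Fintype B] (D : Finset A)
    (E : Finset B) (f : A → B → ℝ) :
    ∃ M : ℝ, ∀ p ∈ simplex D, ∀ q ∈ simplex E,
      |∑ u ∈ D, ∑ v ∈ E, p u * q v * f u v| ≤ M := by
  refine ⟨∑ u ∈ D, ∑ v ∈ E, |f u v|, fun p hp q hq => ?_⟩
  have hf : ∀ u ∈ D, ∀ v ∈ E, |f u v| ≤ ∑ u ∈ D, ∑ v ∈ E, |f u v| := fun u hu v hv =>
    (Finset.single_le_sum (f := fun v => |f u v|) (fun _ _ => abs_nonneg _) hv).trans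
      (Finset.single_le_sum (f := fun u => ∑ v ∈ E, |f u v|)
        (fun _ _ => Finset.sum_nonneg fun _ _ => abs_nonneg _) hu)
  have hle := sum_simplex_le_add hp hq (f := f) (f' := fun _ _ => 0)
    fun u hu v hv => by linarith [hf u hu v hv, le_abs_self (f u v)]
  have hge := sum_simplex_le_add hp hq (f := fun _ _ => 0) (f' := f)
    fun u hu v hv => by linarith [hf u hu v hv, neg_abs_le (f u v)]
  simp only [mul_zero, Finset.sum_const_zero] at hle hge
  exact abs_le.2 ⟨by linarith, by linarith⟩

namespace MarkovGame

variable {S A B : Type*} [Fintype S] [Fintype A] [Fintype B] (G : MarkovGame S A B)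

theorem Aval_le_add (V V' : S → ℝ) (s : S) {u : A} (hu : u ∈ G.U s) {v : B} (hv : v ∈ G.W s) :
    G.Aval V s u v ≤ G.Aval V' s u v + G.α * ‖V - V'‖ := by
  have h : ∑ s', G.P s u v s' * V s' ≤ (∑ s', G.P s u v s' * V' s') + ‖V - V'‖ := by
    calc ∑ s', G.P s u v s' * V s'
        ≤ ∑ s', (G.P s u v s' * V' s' + G.P s u v s' * ‖V - V'‖) := by
          refine Finset.sum_le_sum fun s' _ => ?_
          rw [← mul_add]
          refine mul_le_mul_of_nonneg_left ?_ (G.P_nonneg s u v s')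
          have h₁ : V s' - V' s' ≤ ‖V - V'‖ := (le_abs_self _).trans (norm_le_pi_norm (V - V') s')
          linarith
      _ = _ := by rw [Finset.sum_add_distrib, ← Finset.sum_mul, G.P_sum s u hu v hv, one_mul]
  have h₂ := mul_le_mul_of_nonneg_left h G.α_pos.le
  unfold Aval
  linarith

variable {G} in
theorem norm_Tpol_sub_le {μ : S → A → ℝ} {ν : S → B → ℝ} (hpol : G.IsPolicy μ ν)
    (V V' : S → ℝ) : ‖G.Tpol μ ν V - G.Tpol μ ν V'‖ ≤ G.α * ‖V - V'‖ := by
  have h : ∀ V V' s, G.Tpol μ ν V s ≤ G.Tpol μ ν V' s + G.α * ‖V - V'‖ := fun V V' s =>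
    sum_simplex_le_add (hpol s).1 (hpol s).2 fun _ hu _ hv => G.Aval_le_add V V' s hu hv
  refine (pi_norm_le_iff_of_nonneg (mul_nonneg G.α_pos.le (norm_nonneg _))).2 fun s => ?_
  have h₁ := h V V' s
  have h₂ := h V' V s
  rw [norm_sub_rev] at h₂
  exact abs_sub_le_iff.2 ⟨by linarith, by linarith⟩

theorem T_le_add (V V' : S → ℝ) (s : S) : G.T V s ≤ G.T V' s + G.α * ‖V - V'‖ := by
  obtain ⟨p₀, hp₀⟩ := simplex_nonempty (G.U_nonempty s)
  obtain ⟨q₀, hq₀⟩ := simplex_nonempty (G.W_nonempty s)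
  obtain ⟨M, hM⟩ := exists_abs_sum_simplex_le (G.U s) (G.W s) (G.Aval V s)
  obtain ⟨M', hM'⟩ := exists_abs_sum_simplex_le (G.U s) (G.W s) (G.Aval V' s)
  refine csSup_le ⟨_, p₀, hp₀, rfl⟩ ?_
  rintro _ ⟨p, hp, rfl⟩
  have h_sup : sInf {y | ∃ q ∈ simplex (G.W s),
      y = ∑ u ∈ G.U s, ∑ v ∈ G.W s, p u * q v * G.Aval V' s u v} ≤ G.T V' s := by
    refine le_csSup ⟨M', ?_⟩ ⟨p, hp, rfl⟩
    rintro _ ⟨p', hp', rfl⟩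
    refine le_trans (csInf_le ⟨-M', ?_⟩ ⟨q₀, hq₀, rfl⟩) (abs_le.1 (hM' p' hp' q₀ hq₀)).2
    rintro _ ⟨q, hq, rfl⟩
    exact (abs_le.1 (hM' p' hp' q hq)).1
  refine le_trans ?_ (add_le_add_left h_sup _)
  rw [← sub_le_iff_le_add]
  refine le_csInf ⟨_, q₀, hq₀, rfl⟩ ?_
  rintro _ ⟨q, hq, rfl⟩
  rw [sub_le_iff_le_add]
  refine le_trans (csInf_le ⟨-M, ?_⟩ ⟨q, hq, rfl⟩)
    (sum_simplex_le_add hp hq fun _ hu _ hv => G.Aval_le_add V V' s hu hv)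
  rintro _ ⟨q', hq', rfl⟩
  exact (abs_le.1 (hM p hp q' hq')).1

theorem norm_T_sub_le (V V' : S → ℝ) : ‖G.T V - G.T V'‖ ≤ G.α * ‖V - V'‖ := by
  refine (pi_norm_le_iff_of_nonneg (mul_nonneg G.α_pos.le (norm_nonneg _))).2 fun s => ?_
  have h₁ := G.T_le_add V V' s
  have h₂ := G.T_le_add V' V s
  rw [norm_sub_rev] at h₂
  exact abs_sub_le_iff.2 ⟨by linarith, by linarith⟩

theorem norm_iterate_T_succ_sub_le (V : S → ℝ) (n : ℕ) :
    ‖G.T^[n + 1] V - G.T^[n] V‖ ≤ G.α ^ n * ‖G.T V - V‖ := by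
  induction n with
  | zero => simp
  | succ n ih =>
    have h := G.norm_T_sub_le (G.T^[n + 1] V) (G.T^[n] V)
    rw [← Function.iterate_succ_apply' G.T, ← Function.iterate_succ_apply' G.T] at h
    rw [pow_succ', mul_assoc]
    exact h.trans (mul_le_mul_of_nonneg_left ih G.α_pos.le)

end MarkovGame

/-- Lemma 1: If `(μ,ν)` is an `H`-step lookahead policy for `V`, then
`‖J^{μ,ν} − T^{H−1}V‖_∞ ≤ (α^{H−1}/(1−α))‖TV − V‖_∞`. -/
theorem stmt_7 {S A B : Type*} [Fintype S] [Fintype A] [Fintype B]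
    (G : MarkovGame S A B) (H : ℕ) (hH : 1 ≤ H) (V : S → ℝ)
    (μ : S → A → ℝ) (ν : S → B → ℝ) (hLA : G.IsLookahead H μ ν V)
    (Jmn : S → ℝ) (hfix : G.Tpol μ ν Jmn = Jmn) :
    ‖Jmn - G.T^[H - 1] V‖ ≤ (G.α ^ (H - 1) / (1 - G.α)) * ‖G.T V - V‖ := by
  obtain ⟨n, rfl⟩ := Nat.exists_eq_add_of_le' hH
  obtain ⟨hpol, hLA⟩ := hLA
  rw [Nat.add_sub_cancel] at hLA ⊢
  have h₁ := G.norm_iterate_T_succ_sub_le V n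
  have h₂ := MarkovGame.norm_Tpol_sub_le hpol Jmn (G.T^[n] V)
  rw [hfix, hLA] at h₂
  have h₃ := norm_sub_le_norm_sub_add_norm_sub Jmn (G.T^[n + 1] V) (G.T^[n] V)
  rw [div_mul_eq_mul_div, le_div_iff₀ (sub_pos.2 G.α_lt_one)]
  linarith
end
end

section
/- Let m ≥ 1 and H ≥ 1 be integers, V ∈ ℝ^S, and let (μ,ν) be an H-step lookahead policy for V. Then ‖T_{μ,ν}^m(T^{H−1}V) − T^{H−1}V‖_∞ ≤ (1+α^m)·(α^H + α^{H−1})/(1−α)·‖V − J*‖_∞. -/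
open Finset Filter Topology Matrix

noncomputable section

namespace MarkovGame

variable {S A B : Type*} [Fintype S] [Fintype A] [Fintype B]

lemma simplex_nonempty {A : Type*} [Fintype A] {D : Finset A} (hD : D.Nonempty) :
    (simplex D).Nonempty := by
  classical
  obtain ⟨a, ha⟩ := hD
  refine ⟨Pi.single a 1, fun b => ?_, ?_, fun b hb => ?_⟩
  · by_cases h : b = a
    · subst h; simp
    · simp [h]
  · simp [Pi.single_apply, ha]
  · have h : b ≠ a := fun h => hb (h ▸ ha)
    simp [h]

/-- A bilinear average over two simplices is bounded by any bound on the entries. -/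
lemma abs_bilinear_le {p : A → ℝ} {q : B → ℝ} {D : Finset A} {E : Finset B}
    (hp : p ∈ simplex D) (hq : q ∈ simplex E) {F : A → B → ℝ} {c : ℝ}
    (hF : ∀ u ∈ D, ∀ v ∈ E, |F u v| ≤ c) :
    |∑ u ∈ D, ∑ v ∈ E, p u * q v * F u v| ≤ c := by
  calc |∑ u ∈ D, ∑ v ∈ E, p u * q v * F u v|
      ≤ ∑ u ∈ D, ∑ v ∈ E, |p u * q v * F u v| :=
        (abs_sum_le_sum_abs _ _).trans (sum_le_sum fun u _ => abs_sum_le_sum_abs _ _)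
    _ ≤ ∑ u ∈ D, ∑ v ∈ E, p u * q v * c := by
        refine sum_le_sum fun u hu => sum_le_sum fun v hv => ?_
        have h := mul_nonneg (hp.1 u) (hq.1 v)
        rw [abs_mul, abs_of_nonneg h]
        exact mul_le_mul_of_nonneg_left (hF u hu v hv) h
    _ = (∑ u ∈ D, p u) * (∑ v ∈ E, q v) * c := by
        rw [sum_mul_sum, sum_mul]
        exact sum_congr rfl fun u _ => (sum_mul _ _ _).symm
    _ = c := by rw [hp.2.1, hq.2.1]; ring

lemma abs_Aval_sub_le (G : MarkovGame S A B) (V V' : S → ℝ) {s : S} {u : A} {v : B}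
    (hu : u ∈ G.U s) (hv : v ∈ G.W s) :
    |G.Aval V s u v - G.Aval V' s u v| ≤ G.α * ‖V - V'‖ := by
  have h : G.Aval V s u v - G.Aval V' s u v = G.α * ∑ s', G.P s u v s' * (V - V') s' := by
    simp only [Aval, Pi.sub_apply, mul_sub, sum_sub_distrib]
    ring
  rw [h, abs_mul, abs_of_pos G.α_pos]
  refine mul_le_mul_of_nonneg_left ?_ G.α_pos.le
  calc |∑ s', G.P s u v s' * (V - V') s'|
      ≤ ∑ s', |G.P s u v s' * (V - V') s'| := abs_sum_le_sum_abs _ _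
    _ ≤ ∑ s', G.P s u v s' * ‖V - V'‖ := by
        refine sum_le_sum fun s' _ => ?_
        rw [abs_mul, abs_of_nonneg (G.P_nonneg s u v s')]
        exact mul_le_mul_of_nonneg_left (norm_le_pi_norm (V - V') s') (G.P_nonneg s u v s')
    _ = ‖V - V'‖ := by rw [← sum_mul, G.P_sum s u hu v hv, one_mul]

lemma abs_Aval_le (G : MarkovGame S A B) (V : S → ℝ) {s : S} {u : A} {v : B}
    (hu : u ∈ G.U s) (hv : v ∈ G.W s) :
    |G.Aval V s u v| ≤ 1 + G.α * ‖V‖ := by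
  have h := G.abs_Aval_sub_le V 0 hu hv
  have h0 : G.Aval 0 s u v = G.g s u v := by simp [Aval]
  rw [h0, sub_zero, abs_le] at h
  have := G.g_nonneg s u v
  have := G.g_le_one s u v
  rw [abs_le]
  constructor <;> linarith [h.1, h.2]

lemma abs_bilinear_Aval_sub_le (G : MarkovGame S A B) (V V' : S → ℝ) {s : S}
    {p : A → ℝ} {q : B → ℝ} (hp : p ∈ simplex (G.U s)) (hq : q ∈ simplex (G.W s)) :
    |∑ u ∈ G.U s, ∑ v ∈ G.W s, p u * q v * G.Aval V s u v
      - ∑ u ∈ G.U s, ∑ v ∈ G.W s, p u * q v * G.Aval V' s u v| ≤ G.α * ‖V - V'‖ := by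
  simp only [← sum_sub_distrib, ← mul_sub]
  exact abs_bilinear_le hp hq fun u hu v hv => G.abs_Aval_sub_le V V' hu hv

lemma T_le_T_add (G : MarkovGame S A B) (V V' : S → ℝ) (s : S) :
    G.T V s ≤ G.T V' s + G.α * ‖V - V'‖ := by
  obtain ⟨p₀, hp₀⟩ := simplex_nonempty (G.U_nonempty s)
  obtain ⟨q₀, hq₀⟩ := simplex_nonempty (G.W_nonempty s)
  have hbdd (X : S → ℝ) {p : A → ℝ} (hp : p ∈ simplex (G.U s)) :
      BddBelow {y | ∃ q ∈ simplex (G.W s),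
        y = ∑ u ∈ G.U s, ∑ v ∈ G.W s, p u * q v * G.Aval X s u v} := by
    refine ⟨-(1 + G.α * ‖X‖), ?_⟩
    rintro _ ⟨q, hq, rfl⟩
    exact (abs_le.1 (abs_bilinear_le hp hq fun u hu v hv => G.abs_Aval_le X hu hv)).1
  unfold T
  refine csSup_le ⟨_, p₀, hp₀, rfl⟩ ?_
  rintro _ ⟨p, hp, rfl⟩
  rw [← sub_le_iff_le_add]
  refine le_csSup_of_le ?_ ⟨p, hp, rfl⟩ (le_csInf ⟨_, q₀, hq₀, rfl⟩ ?_)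
  · refine ⟨1 + G.α * ‖V'‖, ?_⟩
    rintro _ ⟨p', hp', rfl⟩
    exact (csInf_le (hbdd V' hp') ⟨q₀, hq₀, rfl⟩).trans
      (abs_le.1 (abs_bilinear_le hp' hq₀ fun u hu v hv => G.abs_Aval_le V' hu hv)).2
  · rintro _ ⟨q, hq, rfl⟩
    have h₁ := csInf_le (hbdd V hp) ⟨q, hq, rfl⟩
    have h₂ := (abs_le.1 (G.abs_bilinear_Aval_sub_le V V' hp hq)).2
    linarith

lemma lipschitzWith_T (G : MarkovGame S A B) : LipschitzWith (NNReal.mk G.α G.α_pos.le) G.T := by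
  refine LipschitzWith.of_dist_le_mul fun V V' => ?_
  rw [dist_eq_norm, dist_eq_norm]
  refine (pi_norm_le_iff_of_nonneg (mul_nonneg G.α_pos.le (norm_nonneg _))).2 fun s => ?_
  have h₁ := G.T_le_T_add V V' s
  have h₂ := G.T_le_T_add V' V s
  rw [norm_sub_rev] at h₂
  rw [Pi.sub_apply, Real.norm_eq_abs, abs_le]
  constructor <;> linarith

lemma IsPolicy.lipschitzWith_Tpol {G : MarkovGame S A B} {μ : S → A → ℝ} {ν : S → B → ℝ}
    (h : G.IsPolicy μ ν) : LipschitzWith (NNReal.mk G.α G.α_pos.le) (G.Tpol μ ν) := by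
  refine LipschitzWith.of_dist_le_mul fun V V' => ?_
  rw [dist_eq_norm, dist_eq_norm]
  refine (pi_norm_le_iff_of_nonneg (mul_nonneg G.α_pos.le (norm_nonneg _))).2 fun s => ?_
  exact G.abs_bilinear_Aval_sub_le V V' (h s).1 (h s).2

lemma dist_T_iterate_le (G : MarkovGame S A B) {J : S → ℝ} (hJ : G.T J = J) (V : S → ℝ)
    (n : ℕ) : dist (G.T^[n] V) J ≤ G.α ^ n * dist V J := by
  have h := (G.lipschitzWith_T.iterate n).dist_le_mul V J
  rwa [Function.iterate_fixed hJ, NNReal.coe_pow, NNReal.coe_mk] at h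

end MarkovGame

/-- If `(μ,ν)` is an `H`-step lookahead policy for `V`, then
`‖T_{μ,ν}^m(T^{H−1}V) − T^{H−1}V‖_∞ ≤ (1+α^m)(α^H+α^{H−1})/(1−α)·‖V − J*‖_∞`. -/
theorem stmt_9 {S A B : Type*} [Fintype S] [Fintype A] [Fintype B]
    (G : MarkovGame S A B) (m H : ℕ) (hm : 1 ≤ m) (hH : 1 ≤ H) (V : S → ℝ)
    (μ : S → A → ℝ) (ν : S → B → ℝ) (hLA : G.IsLookahead H μ ν V)
    (Jstar : S → ℝ) (hJ : G.T Jstar = Jstar) :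
    ‖(G.Tpol μ ν)^[m] (G.T^[H - 1] V) - G.T^[H - 1] V‖ ≤
      (1 + G.α ^ m) * (G.α ^ H + G.α ^ (H - 1)) / (1 - G.α) * ‖V - Jstar‖ := by
  have h_α := G.α_pos
  have hα1 : 0 < 1 - G.α := sub_pos.2 G.α_lt_one
  set X := G.T^[H - 1] V
  have hstep : dist X (G.Tpol μ ν X) ≤ (G.α ^ H + G.α ^ (H - 1)) * dist V Jstar := by
    rw [hLA.2]
    have h₁ := G.dist_T_iterate_le hJ V H
    have h₂ := G.dist_T_iterate_le hJ V (H - 1)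
    have h₃ := dist_triangle_right X (G.T^[H] V) Jstar
    linarith
  have hsum : dist X ((G.Tpol μ ν)^[m] X) ≤
      ∑ i ∈ Finset.range m, dist X (G.Tpol μ ν X) * G.α ^ i :=
    dist_le_range_sum_of_dist_le (f := fun n => (G.Tpol μ ν)^[n] X) m fun {k} _ =>
      hLA.1.lipschitzWith_Tpol.dist_iterate_succ_le_geometric X k
  have hgeom : ∑ i ∈ Finset.range m, G.α ^ i ≤ (1 + G.α ^ m) / (1 - G.α) := by
    rw [le_div_iff₀ hα1, geom_sum_mul_neg]
    linarith [pow_pos h_α m]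
  rw [← dist_eq_norm, ← dist_eq_norm, dist_comm]
  calc dist X ((G.Tpol μ ν)^[m] X)
      ≤ dist X (G.Tpol μ ν X) * ∑ i ∈ Finset.range m, G.α ^ i := by rwa [mul_sum]
    _ ≤ ((G.α ^ H + G.α ^ (H - 1)) * dist V Jstar) * ((1 + G.α ^ m) / (1 - G.α)) := by
        gcongr
    _ = _ := by ring
end
end

section
/- (Lemma 2, noiseless version) Let E be a finite-dimensional real normed vector space, J* ∈ E, H : E → E, and let β ∈ [0,1) and δ ≥ 0 be such that ‖H(V) − J*‖ ≤ β‖V − J*‖ + δ for all V ∈ E. Let (γ_k)_{k≥0} be a sequence with γ_k ∈ (0,1] for all k and Σ_{k=0}^∞ γ_k = ∞, and define V_{k+1} = (1−γ_k)V_k + γ_k H(V_k) from any V_0 ∈ E. Then limsup_{k→∞} ‖V_k − J*‖ ≤ δ/(1−β). -/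
open Finset Filter Topology Matrix

noncomputable section

/-- A real sequence that contracts multiplicatively by `1 - a * γ k` at each step is bounded by the
exponential of the accumulated step sizes. -/
theorem le_exp_neg_mul_sum_of_le_one_sub_mul {a : ℝ} {γ y : ℕ → ℝ}
    (hγ : ∀ k, 0 ≤ 1 - a * γ k) (hy : ∀ k, y (k + 1) ≤ (1 - a * γ k) * y k) (n : ℕ) :
    y n ≤ Real.exp (-(a * ∑ k ∈ Finset.range n, γ k)) * max (y 0) 0 := by
  induction n with
  | zero => simp
  | succ n ih =>
    calc y (n + 1) ≤ (1 - a * γ n) * y n := hy n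
      _ ≤ (1 - a * γ n) * (Real.exp (-(a * ∑ k ∈ Finset.range n, γ k)) * max (y 0) 0) :=
        mul_le_mul_of_nonneg_left ih (hγ n)
      _ ≤ Real.exp (-(a * γ n)) *
          (Real.exp (-(a * ∑ k ∈ Finset.range n, γ k)) * max (y 0) 0) :=
        mul_le_mul_of_nonneg_right (Real.one_sub_le_exp_neg _) (by positivity)
      _ = Real.exp (-(a * ∑ k ∈ Finset.range (n + 1), γ k)) * max (y 0) 0 := by
        rw [← mul_assoc, ← Real.exp_add, Finset.sum_range_succ]
        ring_nf

/-- Lemma 2, noiseless version: Let `E` be a finite-dimensional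
real normed vector space, `f : E → E` with `‖f(V) − J*‖ ≤ β‖V − J*‖ + δ` for all
`V`, where `β ∈ [0,1)` and `δ ≥ 0`. For step sizes `γ_k ∈ (0,1]` with
`Σ γ_k = ∞` and the recursion `V_{k+1} = (1−γ_k)V_k + γ_k f(V_k)`,
`limsup_k ‖V_k − J*‖ ≤ δ/(1−β)`. -/
theorem stmt_17 {E : Type*} [NormedAddCommGroup E] [NormedSpace ℝ E]
    [FiniteDimensional ℝ E]
    (Jstar : E) (f : E → E) (β δ : ℝ) (hβ0 : 0 ≤ β) (hβ1 : β < 1) (hδ : 0 ≤ δ)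
    (hf : ∀ V : E, ‖f V - Jstar‖ ≤ β * ‖V - Jstar‖ + δ)
    (γ : ℕ → ℝ) (hγ : ∀ k, γ k ∈ Set.Ioc (0 : ℝ) 1)
    (hγsum : Tendsto (fun n => ∑ k ∈ Finset.range n, γ k) atTop atTop)
    (Vseq : ℕ → E)
    (hiter : ∀ k, Vseq (k + 1) = (1 - γ k) • Vseq k + γ k • f (Vseq k)) :
    limsup (fun k => ‖Vseq k - Jstar‖) atTop ≤ δ / (1 - β) := by
  have ha : 0 < 1 - β := sub_pos.2 hβ1
  set c := δ / (1 - β) with hc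
  have hδc : δ = (1 - β) * c := by rw [hc]; field_simp
  have hstep : ∀ k, ‖Vseq (k + 1) - Jstar‖ - c ≤
      (1 - (1 - β) * γ k) * (‖Vseq k - Jstar‖ - c) := by
    intro k
    obtain ⟨h0, h1⟩ := hγ k
    have hdecomp : Vseq (k + 1) - Jstar =
        (1 - γ k) • (Vseq k - Jstar) + γ k • (f (Vseq k) - Jstar) := by
      rw [hiter k]; module
    have hnorm : ‖Vseq (k + 1) - Jstar‖ ≤
        (1 - γ k) * ‖Vseq k - Jstar‖ + γ k * ‖f (Vseq k) - Jstar‖ := by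
      rw [hdecomp]
      refine (norm_add_le _ _).trans_eq ?_
      rw [norm_smul_of_nonneg (sub_nonneg.2 h1), norm_smul_of_nonneg h0.le]
    have hmul := mul_le_mul_of_nonneg_left (hf (Vseq k)) h0.le
    rw [hδc] at hmul
    linarith
  have hcoef : ∀ k, 0 ≤ 1 - (1 - β) * γ k := fun k => by
    obtain ⟨h0, h1⟩ := hγ k
    nlinarith
  have hbound : ∀ n, ‖Vseq n - Jstar‖ ≤
      Real.exp (-((1 - β) * ∑ k ∈ Finset.range n, γ k)) * max (‖Vseq 0 - Jstar‖ - c) 0 + c :=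
    fun n => sub_le_iff_le_add.1 <| le_exp_neg_mul_sum_of_le_one_sub_mul
      (y := fun k => ‖Vseq k - Jstar‖ - c) hcoef hstep n
  have hlim : Tendsto (fun n => Real.exp (-((1 - β) * ∑ k ∈ Finset.range n, γ k)) *
      max (‖Vseq 0 - Jstar‖ - c) 0 + c) atTop (𝓝 c) := by
    simpa using ((Real.tendsto_exp_neg_atTop_nhds_zero.comp
      (hγsum.const_mul_atTop ha)).mul_const (max (‖Vseq 0 - Jstar‖ - c) 0)).add_const c
  rw [← hlim.limsup_eq]
  exact limsup_le_limsup (Eventually.of_forall hbound)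
    (isCoboundedUnder_le_of_le atTop fun k => norm_nonneg (Vseq k - Jstar))
    hlim.isBoundedUnder_le
end
end
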